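/- Let n > 2. The constant n²/4 in the uncertainty principle inequality on ℍⁿ is sharp: the infimum, over all nonzero φ ∈ C_c^∞(B), of the quotient ( ∫_B d² φ² λ^n dx ) ( ∫_B |∇φ|² λ^{n-2} dx ) / ( ∫_B φ² λ^n dx )² equals n²/4; equality is attained in the limit by hyperbolic Gaussians φ(x) = A e^{-α d(x)²}. -/

import Mathlib

open MeasureTheory

/-- Conformal factor of the Poincaré ball model. -/
noncomputable def lam {n : ℕ} (x : EuclideanSpace ℝ (Fin n)) : ℝ := 2 / (1 - ‖x‖ ^ 2)

/-- Hyperbolic distance to the origin in the Poincaré ball model. -/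
noncomputable def dH {n : ℕ} (x : EuclideanSpace ℝ (Fin n)) : ℝ :=
  Real.log ((1 + ‖x‖) / (1 - ‖x‖))

open Filter Topology

theorem lam_pos {n : ℕ} {x : EuclideanSpace ℝ (Fin n)} (hx : ‖x‖ < 1) : 0 < lam x := by
  have := norm_nonneg x
  exact div_pos two_pos (by nlinarith)

theorem lam_mul {n : ℕ} {x : EuclideanSpace ℝ (Fin n)} (hx : ‖x‖ < 1) :
    lam x * (1 - ‖x‖ ^ 2) = 2 := by
  have := norm_nonneg x
  exact div_mul_cancel₀ _ (by nlinarith)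

theorem hasFDerivAt_lam {n : ℕ} {x : EuclideanSpace ℝ (Fin n)} (hx : ‖x‖ < 1) :
    HasFDerivAt lam (lam x ^ 2 • innerSL ℝ x) x := by
  have hx0 := norm_nonneg x
  have h0 : (1 - ‖x‖ ^ 2) ≠ 0 := by nlinarith
  have h1 := (hasStrictFDerivAt_norm_sq x).hasFDerivAt.const_sub 1
  have h2 := ((hasDerivAt_inv h0).const_mul 2).comp_hasFDerivAt x h1
  refine h2.congr_fderiv ?_
  ext v
  simp only [lam, smul_apply, neg_apply, smul_eq_mul, nsmul_eq_mul]
  field_simp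
  simp

theorem contDiffAt_lam {n : ℕ} {x : EuclideanSpace ℝ (Fin n)} (hx : ‖x‖ < 1) {k : WithTop ℕ∞} :
    ContDiffAt ℝ k lam x := by
  have hx0 := norm_nonneg x
  exact contDiffAt_const.div (contDiffAt_const.sub (contDiff_norm_sq ℝ).contDiffAt) (by nlinarith)

theorem continuousOn_lam {n : ℕ} :
    ContinuousOn lam (Metric.ball (0 : EuclideanSpace ℝ (Fin n)) 1) := fun _ hx =>
  (contDiffAt_lam (k := 0) (mem_ball_zero_iff.1 hx)).continuousAt.continuousWithinAt

theorem continuousOn_dH {n : ℕ} :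
    ContinuousOn dH (Metric.ball (0 : EuclideanSpace ℝ (Fin n)) 1) := by
  intro x hx
  have hx1 := mem_ball_zero_iff.1 hx
  have hx0 := norm_nonneg x
  refine ContinuousAt.continuousWithinAt ?_
  have h1 : 1 - ‖x‖ ≠ 0 := by linarith
  have h2 : (1 + ‖x‖) / (1 - ‖x‖) ≠ 0 := div_ne_zero (by positivity) h1
  unfold dH
  fun_prop (disch := assumption)

theorem two_mul_norm_le_dH {n : ℕ} {x : EuclideanSpace ℝ (Fin n)} (hx : ‖x‖ < 1) :
    2 * ‖x‖ ≤ dH x := by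
  have := Real.sum_range_le_log_div (norm_nonneg x) hx 1
  simp at this
  unfold dH
  linarith

theorem dH_le_four_mul_norm {n : ℕ} {x : EuclideanSpace ℝ (Fin n)} (hx : ‖x‖ ≤ 1 / 2) :
    dH x ≤ 4 * ‖x‖ := by
  have hx0 := norm_nonneg x
  have h1 : 0 < 1 - ‖x‖ := by linarith
  refine (Real.log_le_sub_one_of_pos (by positivity)).trans ?_
  rw [div_sub_one h1.ne', div_le_iff₀ h1]
  nlinarith

theorem continuous_mul_of_tsupport_subset {X : Type*} [TopologicalSpace X] {f g : X → ℝ} {U : Set X}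
    (hf : Continuous f) (hU : IsOpen U) (hs : tsupport f ⊆ U) (hg : ContinuousOn g U) :
    Continuous fun x => f x * g x :=
  (hf.continuousOn.mul hg).continuous_of_tsupport_subset hU ((tsupport_mul_subset_left).trans hs)

theorem integrable_mul_of_tsupport_subset {n : ℕ} {f g : EuclideanSpace ℝ (Fin n) → ℝ}
    (hf : Continuous f) (hc : HasCompactSupport f) (hs : tsupport f ⊆ Metric.ball 0 1)
    (hg : ContinuousOn g (Metric.ball 0 1)) : Integrable fun x => f x * g x :=
  (continuous_mul_of_tsupport_subset hf Metric.isOpen_ball hs hg).integrable_of_hasCompactSupport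
    hc.mul_right

/-- The divergence of `w x • x` has vanishing integral. -/
theorem integral_fderiv_apply_self {n : ℕ} {w : EuclideanSpace ℝ (Fin n) → ℝ}
    (hw : ContDiff ℝ 1 w) (h0 : Integrable w) (h1 : Integrable fun x => ‖x‖ * w x)
    (h2 : Integrable fun x => ‖x‖ * ‖fderiv ℝ w x‖) :
    ∫ x, fderiv ℝ w x x = -(n * ∫ x, w x) := by
  have hcd : Continuous (fderiv ℝ w) := hw.continuous_fderiv one_ne_zero
  have hcw := hw.continuous
  have key (i : Fin n) : Integrable (fun x => x i * fderiv ℝ w x (EuclideanSpace.single i 1)) ∧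
      ∫ x, x i * fderiv ℝ w x (EuclideanSpace.single i 1) = -∫ x, w x := by
    have hd (x : EuclideanSpace ℝ (Fin n)) : HasFDerivAt (fun x : EuclideanSpace ℝ (Fin n) => x i)
        (EuclideanSpace.proj i : EuclideanSpace ℝ (Fin n) →L[ℝ] ℝ) x :=
      (EuclideanSpace.proj i : EuclideanSpace ℝ (Fin n) →L[ℝ] ℝ).hasFDerivAt
    have hd' (x : EuclideanSpace ℝ (Fin n)) :
        fderiv ℝ (fun x : EuclideanSpace ℝ (Fin n) => x i) x (EuclideanSpace.single i 1) = 1 := by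
      simp [(hd x).fderiv]
    have hI : Integrable (fun x => x i * fderiv ℝ w x (EuclideanSpace.single i 1)) := by
      refine h2.mono (by fun_prop) (Eventually.of_forall fun x => ?_)
      rw [norm_mul, norm_mul, norm_norm, norm_norm]
      gcongr
      · exact PiLp.norm_apply_le x i
      · exact (ContinuousLinearMap.le_opNorm _ _).trans (by simp)
    refine ⟨hI, ?_⟩
    rw [integral_mul_fderiv_eq_neg_fderiv_mul_of_integrable (by simpa [hd'] using h0) hI ?_
      (fun x _ => (hd x).differentiableAt) (fun x _ => hw.differentiable one_ne_zero x)]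
    · simp [hd']
    · refine h1.mono (by fun_prop) (Eventually.of_forall fun x => ?_)
      rw [norm_mul, norm_mul, norm_norm]
      gcongr
      exact PiLp.norm_apply_le x i
  have hsum (x : EuclideanSpace ℝ (Fin n)) :
      fderiv ℝ w x x = ∑ i, x i * fderiv ℝ w x (EuclideanSpace.single i 1) := by
    conv_lhs => enter [2]; rw [← (EuclideanSpace.basisFun (Fin n) ℝ).sum_repr x]
    rw [map_sum]
    simp
  simp_rw [hsum]
  rw [integral_finsetSum _ fun i _ => (key i).1]
  simp [(key _).2]

theorem fderiv_mul_lam_pow_apply_self {m : ℕ}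
    {φ : EuclideanSpace ℝ (Fin (m + 2)) → ℝ} {x : EuclideanSpace ℝ (Fin (m + 2))}
    (hφ : DifferentiableAt ℝ φ x) (hx : ‖x‖ < 1) :
    fderiv ℝ (fun x => φ x ^ 2 * lam x ^ (m + 1)) x x =
      φ x ^ 2 * ((m + 1) * lam x ^ (m + 2) * ‖x‖ ^ 2) +
        2 * φ x * fderiv ℝ φ x x * lam x ^ (m + 1) := by
  rw [show (fun x => φ x ^ 2 * lam x ^ (m + 1)) = (fun x => φ x ^ 2) * fun x => lam x ^ (m + 1)
    from rfl, ((hφ.hasFDerivAt.pow 2).mul ((hasFDerivAt_lam hx).pow (m + 1))).fderiv]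
  simp
  ring

/-- The uncertainty principle at a point: `a`, `p`, `q` stand for `φ x`, `fderiv ℝ φ x x` and
`‖fderiv ℝ φ x‖`, and the last summand is a divergence. -/
theorem weighted_sq_le_add_divergence {m : ℕ} {s a p q r l d : ℝ} (hs : 0 ≤ s) (hr : 0 ≤ r)
    (hl : 0 < l) (hlr : l * (1 - r ^ 2) = 2) (hd : 2 * r ≤ d) (hp : |p| ≤ q * r) :
    (m + 2) * s * (a ^ 2 * l ^ (m + 2)) ≤
      s ^ 2 * (a ^ 2 * (d ^ 2 * l ^ (m + 2))) + q ^ 2 * l ^ m +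
      2 * s * ((a ^ 2 * ((m + 1) * l ^ (m + 2) * r ^ 2) + 2 * a * p * l ^ (m + 1)) +
        (m + 2) * (a ^ 2 * l ^ (m + 1))) := by
  have hp2 : p ^ 2 ≤ q ^ 2 * r ^ 2 := by
    rw [← mul_pow, ← sq_abs]; gcongr
  have hd2 : (2 * r) ^ 2 ≤ d ^ 2 := by gcongr
  have hcross : -(4 * s * a * p * l) ≤ s ^ 2 * a ^ 2 * d ^ 2 * l ^ 2 + q ^ 2 := by
    have h1 : |4 * s * a * p * l| ≤ 2 * (2 * s * |a| * r * l) * q := by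
      rw [abs_mul, abs_mul, abs_mul, abs_mul, abs_of_nonneg hs, abs_of_pos hl]
      have := mul_le_mul_of_nonneg_left hp (by positivity : 0 ≤ 4 * s * |a| * l)
      have h4 : |(4 : ℝ)| = 4 := abs_of_pos four_pos
      rw [h4]
      linarith
    have h2 := mul_le_mul_of_nonneg_left hd2 (by positivity : 0 ≤ s ^ 2 * a ^ 2 * l ^ 2)
    have h3 := sq_nonneg (2 * s * |a| * r * l - q)
    have h4 := neg_abs_le (4 * s * a * p * l)
    have h5 : (2 * s * |a| * r * l - q) ^ 2 = s ^ 2 * a ^ 2 * l ^ 2 * (2 * r) ^ 2 -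
        2 * (2 * s * |a| * r * l) * q + q ^ 2 := by rw [← sq_abs a]; ring
    linarith
  have hcross' := mul_le_mul_of_nonneg_left hcross (pow_pos hl m).le
  have hdiv : 0 ≤ s * a ^ 2 * l ^ (m + 2) * (m * r ^ 2) := by positivity
  have e : l ^ (m + 1) = l ^ (m + 2) * (1 - r ^ 2) / 2 := by
    rw [pow_succ l (m + 1), mul_assoc, hlr]; ring
  have e2 : (m + 2) * (a ^ 2 * l ^ (m + 1)) =
      (m + 2) * (a ^ 2 * (l ^ (m + 2) * (1 - r ^ 2) / 2)) := by rw [e]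
  rw [e2]
  ring_nf at *
  linarith

/-- The uncertainty principle, in integrals over the whole space. -/
theorem uncertainty_principle {m : ℕ} {φ : EuclideanSpace ℝ (Fin (m + 2)) → ℝ}
    (hφ : ContDiff ℝ 1 φ) (hc : HasCompactSupport φ) (hs : tsupport φ ⊆ Metric.ball 0 1) :
    ((m : ℝ) + 2) ^ 2 * (∫ x, φ x ^ 2 * lam x ^ (m + 2)) ^ 2 ≤
      4 * (∫ x, φ x ^ 2 * (dH x ^ 2 * lam x ^ (m + 2))) *
        ∫ x, ‖fderiv ℝ φ x‖ ^ 2 * lam x ^ m := by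
  have hφc := hφ.continuous
  have hcd : Continuous (fderiv ℝ φ) := hφ.continuous_fderiv one_ne_zero
  have hsq : tsupport (fun x => φ x ^ 2) ⊆ tsupport φ := by
    simpa only [sq] using! tsupport_mul_subset_left (f := φ) (g := φ)
  have hcsq : HasCompactSupport (fun x => φ x ^ 2) := hc.comp_left (g := fun t => t ^ 2) (by simp)
  have hsg : tsupport (fun x => ‖fderiv ℝ φ x‖ ^ 2) ⊆ tsupport φ := by
    refine (closure_mono fun x hx => ?_).trans (tsupport_fderiv_subset ℝ)
    contrapose! hx
    simp_all
  have hcg : HasCompactSupport (fun x => ‖fderiv ℝ φ x‖ ^ 2) :=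
    hc.of_isClosed_subset (isClosed_tsupport _) hsg
  have hlam (k : ℕ) : ContinuousOn (fun x : EuclideanSpace ℝ (Fin (m + 2)) => lam x ^ k)
    (Metric.ball 0 1) := continuousOn_lam.pow k
  have iA : Integrable fun x => φ x ^ 2 * (dH x ^ 2 * lam x ^ (m + 2)) :=
    integrable_mul_of_tsupport_subset (by fun_prop) hcsq (hsq.trans hs)
      ((continuousOn_dH.pow 2).mul (hlam _))
  have iB : Integrable fun x => ‖fderiv ℝ φ x‖ ^ 2 * lam x ^ m :=
    integrable_mul_of_tsupport_subset (by fun_prop) hcg (hsg.trans hs) (hlam _)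
  have iC : Integrable fun x => φ x ^ 2 * lam x ^ (m + 2) :=
    integrable_mul_of_tsupport_subset (by fun_prop) hcsq (hsq.trans hs) (hlam _)
  set w := fun x => φ x ^ 2 * lam x ^ (m + 1) with hw
  have hwφ : tsupport w ⊆ tsupport φ := (tsupport_mul_subset_left).trans hsq
  have hwc : HasCompactSupport w := hcsq.mul_right
  have hwd : ContDiff ℝ 1 w := by
    rw [contDiff_iff_contDiffAt]
    intro x
    by_cases hx : x ∈ tsupport w
    · exact (hφ.contDiffAt.pow 2).mul ((contDiffAt_lam (mem_ball_zero_iff.1 (hs (hwφ hx)))).pow _)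
    · exact contDiffAt_const.congr_of_eventuallyEq (notMem_tsupport_iff_eventuallyEq.1 hx)
  have hwcont := hwd.continuous
  have hwcd : Continuous (fderiv ℝ w) := hwd.continuous_fderiv one_ne_zero
  have iw : Integrable w := hwcont.integrable_of_hasCompactSupport hwc
  have hdiv := integral_fderiv_apply_self hwd iw
    ((continuous_norm.mul hwcont).integrable_of_hasCompactSupport hwc.mul_left)
    ((continuous_norm.mul hwcd.norm).integrable_of_hasCompactSupport (hwc.fderiv ℝ).norm.mul_left)
  have iD : Integrable fun x => fderiv ℝ w x x :=
    (by fun_prop : Continuous fun x => fderiv ℝ w x x).integrable_of_hasCompactSupport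
      ((hwc.fderiv ℝ).mono fun x hx => by contrapose! hx; simp_all)
  have iDw : Integrable fun x => fderiv ℝ w x x + (m + 2) * w x := iD.add (iw.const_mul _)
  have iAB (s : ℝ) : Integrable fun x =>
      s ^ 2 * (φ x ^ 2 * (dH x ^ 2 * lam x ^ (m + 2))) + ‖fderiv ℝ φ x‖ ^ 2 * lam x ^ m :=
    (iA.const_mul _).add iB
  set A := ∫ x, φ x ^ 2 * (dH x ^ 2 * lam x ^ (m + 2))
  set B := ∫ x, ‖fderiv ℝ φ x‖ ^ 2 * lam x ^ m
  set C := ∫ x, φ x ^ 2 * lam x ^ (m + 2)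
  have hoff (x) (hx : x ∉ tsupport φ) : φ x = 0 ∧ fderiv ℝ φ x = 0 ∧ fderiv ℝ w x = 0 :=
    ⟨image_eq_zero_of_notMem_tsupport hx,
      image_eq_zero_of_notMem_tsupport fun h => hx (tsupport_fderiv_subset ℝ h),
      image_eq_zero_of_notMem_tsupport fun h => hx (hwφ (tsupport_fderiv_subset ℝ h))⟩
  have hnonneg {f : EuclideanSpace ℝ (Fin (m + 2)) → ℝ}
      (hf : ∀ x, ‖x‖ < 1 → 0 ≤ f x) (hf' : ∀ x, x ∉ tsupport φ → f x = 0) : 0 ≤ ∫ x, f x := by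
    refine integral_nonneg fun x => ?_
    by_cases hx : x ∈ tsupport φ
    · exact hf x (mem_ball_zero_iff.1 (hs hx))
    · exact (hf' x hx).ge
  have hA0 : 0 ≤ A := hnonneg (fun x hx => by have := lam_pos hx; positivity)
    fun x hx => by simp [(hoff x hx).1]
  have hB0 : 0 ≤ B := hnonneg (fun x hx => by have := lam_pos hx; positivity)
    fun x hx => by simp [(hoff x hx).2.1]
  have hC0 : 0 ≤ C := hnonneg (fun x hx => by have := lam_pos hx; positivity)
    fun x hx => by simp [(hoff x hx).1]
  have hquad (s : ℝ) : 0 ≤ A * (s * s) + -((m + 2) * C) * s + B := by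
    rcases le_or_gt 0 s with h | h
    · have : ∫ x, (m + 2) * s * (φ x ^ 2 * lam x ^ (m + 2)) ≤
          ∫ x, (s ^ 2 * (φ x ^ 2 * (dH x ^ 2 * lam x ^ (m + 2))) + ‖fderiv ℝ φ x‖ ^ 2 * lam x ^ m +
            2 * s * (fderiv ℝ w x x + (m + 2) * w x)) := by
        refine integral_mono (iC.const_mul _)
          ((iAB s).add (iDw.const_mul _)) fun x => ?_
        by_cases hx : x ∈ tsupport φ
        · have hx1 := mem_ball_zero_iff.1 (hs hx)
          simp only [hw]
          rw [fderiv_mul_lam_pow_apply_self (hφ.differentiable one_ne_zero x) hx1]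
          exact weighted_sq_le_add_divergence h (norm_nonneg x) (lam_pos hx1) (lam_mul hx1)
            (two_mul_norm_le_dH hx1) ((fderiv ℝ φ x).le_opNorm x)
        · obtain ⟨h1, h2, h3⟩ := hoff x hx
          have h4 : w x = 0 := by simp [hw, h1]
          simp [h1, h2, h3, h4]
      rw [integral_add (iAB s) (iDw.const_mul _), integral_add (iA.const_mul _) iB,
        integral_const_mul, integral_const_mul, integral_const_mul,
        integral_add iD (iw.const_mul _), integral_const_mul, hdiv] at this
      push_cast at this
      linarith
    · have h1 : 0 ≤ A * (s * s) := mul_nonneg hA0 (mul_self_nonneg s)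
      have h2 : 0 ≤ (m + 2) * C * (-s) := mul_nonneg (by positivity) (by linarith)
      linarith
  have := discrim_le_zero hquad
  rw [discrim] at this
  linarith

theorem integrable_exp_neg_mul_norm_sq {n : ℕ} {b : ℝ} (hb : 0 < b) :
    Integrable fun x : EuclideanSpace ℝ (Fin n) => Real.exp (-b * ‖x‖ ^ 2) := by
  refine .of_integral_ne_zero ?_
  rw [GaussianFourier.integral_rexp_neg_mul_sq_norm hb]
  exact (Real.rpow_pos_of_pos (by positivity) _).ne'

theorem integrable_one_add_norm_sq_mul_exp {n : ℕ} :
    Integrable fun x : EuclideanSpace ℝ (Fin n) => (1 + ‖x‖ ^ 2) * Real.exp (-‖x‖ ^ 2) := by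
  refine ((integrable_exp_neg_mul_norm_sq (n := n) one_half_pos).const_mul 2).mono'
    (by fun_prop) (Eventually.of_forall fun x => ?_)
  rw [Real.norm_of_nonneg (by positivity)]
  have h1 := Real.add_one_le_exp (‖x‖ ^ 2 / 2)
  have h2 : Real.exp (-(1 / 2) * ‖x‖ ^ 2) = Real.exp (‖x‖ ^ 2 / 2) * Real.exp (-‖x‖ ^ 2) := by
    rw [← Real.exp_add]; ring_nf
  rw [h2, ← mul_assoc]
  gcongr
  linarith

theorem integrable_mul_exp_neg_norm_sq {n : ℕ} {f : EuclideanSpace ℝ (Fin n) → ℝ} {C : ℝ}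
    (hf : AEStronglyMeasurable f) (hb : ∀ x, |f x| ≤ C * (1 + ‖x‖ ^ 2)) :
    Integrable fun x => f x * Real.exp (-‖x‖ ^ 2) := by
  refine (integrable_one_add_norm_sq_mul_exp.const_mul C).mono'
    (hf.mul (by fun_prop)) (Eventually.of_forall fun x => ?_)
  rw [norm_mul, Real.norm_eq_abs, Real.norm_of_nonneg (Real.exp_pos _).le, ← mul_assoc]
  gcongr
  exact hb x

theorem integral_exp_neg_norm_sq_pos {n : ℕ} :
    0 < ∫ x : EuclideanSpace ℝ (Fin n), Real.exp (-‖x‖ ^ 2) := by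
  have h := GaussianFourier.integral_rexp_neg_mul_sq_norm (V := EuclideanSpace ℝ (Fin n)) one_pos
  simp only [neg_mul, one_mul] at h
  rw [h]
  exact Real.rpow_pos_of_pos (by positivity) _

theorem integral_norm_sq_mul_exp {n : ℕ} :
    ∫ x : EuclideanSpace ℝ (Fin n), ‖x‖ ^ 2 * Real.exp (-‖x‖ ^ 2) =
      n / 2 * ∫ x : EuclideanSpace ℝ (Fin n), Real.exp (-‖x‖ ^ 2) := by
  have hd (x : EuclideanSpace ℝ (Fin n)) : fderiv ℝ (fun x => Real.exp (-‖x‖ ^ 2)) x =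
      (-2 * Real.exp (-‖x‖ ^ 2)) • innerSL ℝ x := by
    have h : HasFDerivAt (fun x : EuclideanSpace ℝ (Fin n) => Real.exp (-‖x‖ ^ 2)) _ x :=
      (hasStrictFDerivAt_norm_sq x).hasFDerivAt.neg.exp
    rw [h.fderiv]
    ext v
    simp
    ring
  have h := integral_fderiv_apply_self (n := n) (w := fun x => Real.exp (-‖x‖ ^ 2))
    (Real.contDiff_exp.comp (contDiff_norm_sq ℝ).neg) ?_ ?_ ?_
  · simp only [hd] at h
    rw [integral_congr_ae (g := fun x : EuclideanSpace ℝ (Fin n) =>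
      -2 * (‖x‖ ^ 2 * Real.exp (-‖x‖ ^ 2))) (Eventually.of_forall fun x => by simp; ring),
      integral_const_mul] at h
    linarith
  · simpa using integrable_mul_exp_neg_norm_sq (n := n) (f := fun _ => 1) (C := 1) (by fun_prop)
      fun x => by simp
  · refine integrable_mul_exp_neg_norm_sq (C := 1) (by fun_prop) fun x => ?_
    rw [abs_norm]
    nlinarith [sq_nonneg (‖x‖ - 1)]
  · have h3 := integrable_mul_exp_neg_norm_sq (n := n) (f := fun x => 2 * ‖x‖ ^ 2) (C := 2)
      (by fun_prop) fun x => by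
        rw [abs_of_nonneg (by positivity)]
        linarith
    refine h3.congr (Eventually.of_forall fun x => ?_)
    simp only [hd, norm_smul, innerSL_apply_norm, norm_mul, Real.norm_eq_abs, Real.abs_exp]
    norm_num
    ring

theorem tendsto_integral_mul_exp_neg_norm_sq {n : ℕ} {F : ℝ → EuclideanSpace ℝ (Fin n) → ℝ}
    {f : EuclideanSpace ℝ (Fin n) → ℝ} {C : ℝ} (hF : ∀ ε, Measurable (F ε))
    (hb : ∀ ε, 0 < ε → ε ≤ 1 → ∀ y, |F ε y| ≤ C * (1 + ‖y‖ ^ 2))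
    (hlim : ∀ y, Tendsto (fun ε => F ε y) (𝓝[>] 0) (𝓝 (f y))) :
    Tendsto (fun ε => ∫ y, F ε y * Real.exp (-‖y‖ ^ 2)) (𝓝[>] 0)
      (𝓝 (∫ y, f y * Real.exp (-‖y‖ ^ 2))) := by
  refine tendsto_integral_filter_of_dominated_convergence
    (fun y => C * ((1 + ‖y‖ ^ 2) * Real.exp (-‖y‖ ^ 2)))
    (Eventually.of_forall fun ε => (hF ε).aestronglyMeasurable.mul (by fun_prop)) ?_
    (integrable_one_add_norm_sq_mul_exp.const_mul C)
    (Eventually.of_forall fun y => (hlim y).mul_const _)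
  filter_upwards [Ioc_mem_nhdsGT (zero_lt_one' ℝ)] with ε hε
  refine Eventually.of_forall fun y => ?_
  rw [norm_mul, Real.norm_eq_abs, Real.norm_of_nonneg (Real.exp_pos _).le, ← mul_assoc]
  gcongr
  exact hb ε hε.1 hε.2 y

theorem measurable_lam {n : ℕ} : Measurable (lam : EuclideanSpace ℝ (Fin n) → ℝ) := by
  unfold lam; fun_prop

theorem measurable_dH {n : ℕ} : Measurable (dH : EuclideanSpace ℝ (Fin n) → ℝ) := by
  unfold dH; fun_prop

theorem lam_le_three {n : ℕ} {x : EuclideanSpace ℝ (Fin n)} (hx : ‖x‖ ≤ 1 / 2) : lam x ≤ 3 := by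
  have hx0 := norm_nonneg x
  unfold lam
  rw [div_le_iff₀ (by nlinarith)]
  nlinarith

theorem tendsto_smul_nhdsGT_zero {n : ℕ} (y : EuclideanSpace ℝ (Fin n)) :
    Tendsto (fun ε : ℝ => ε • y) (𝓝[>] 0) (𝓝 0) := by
  have : Tendsto (fun ε : ℝ => ε • y) (𝓝 0) (𝓝 ((0 : ℝ) • y)) :=
    (continuous_id.smul continuous_const).tendsto 0
  rw [zero_smul] at this
  exact this.mono_left nhdsWithin_le_nhds

theorem tendsto_lam_smul {n : ℕ} (y : EuclideanSpace ℝ (Fin n)) :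
    Tendsto (fun ε : ℝ => lam (ε • y)) (𝓝[>] 0) (𝓝 2) := by
  have h : ContinuousAt lam (0 : EuclideanSpace ℝ (Fin n)) :=
    (contDiffAt_lam (k := 0) (by simp)).continuousAt
  have h' := h.tendsto.comp (tendsto_smul_nhdsGT_zero y)
  simpa [lam] using! h'

theorem tendsto_dH_smul_div {n : ℕ} (y : EuclideanSpace ℝ (Fin n)) :
    Tendsto (fun ε : ℝ => ε⁻¹ * dH (ε • y)) (𝓝[>] 0) (𝓝 (2 * ‖y‖)) := by
  have h : HasDerivAt (fun t : ℝ => Real.log ((1 + t * ‖y‖) / (1 - t * ‖y‖))) (2 * ‖y‖) 0 := by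
    have h1 := ((hasDerivAt_id (0 : ℝ)).mul_const ‖y‖).const_add 1
    have h2 := ((hasDerivAt_id (0 : ℝ)).mul_const ‖y‖).const_sub 1
    convert! (h1.div h2 (by simp)).log (by simp) using 1
    simp
    ring
  refine h.tendsto_slope_zero_right.congr' ?_
  filter_upwards [self_mem_nhdsWithin] with ε (hε : 0 < ε)
  simp [dH, norm_smul, abs_of_pos hε]

/-- A Gaussian of width `ε` cut off by `χ`. -/
noncomputable def cutoffGaussian {n : ℕ} (χ : EuclideanSpace ℝ (Fin n) → ℝ) (ε : ℝ)
    (x : EuclideanSpace ℝ (Fin n)) : ℝ :=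
  χ x * Real.exp (-((ε⁻¹) ^ 2 / 2) * ‖x‖ ^ 2)

theorem exp_neg_mul_norm_smul_sq {n : ℕ} {ε : ℝ} (hε : 0 < ε) (y : EuclideanSpace ℝ (Fin n)) :
    Real.exp (-((ε⁻¹) ^ 2 / 2) * ‖ε • y‖ ^ 2) ^ 2 = Real.exp (-‖y‖ ^ 2) := by
  rw [← Real.exp_nat_mul, norm_smul, Real.norm_of_nonneg hε.le]
  congr 1
  field_simp
  simp

theorem cutoffGaussian_smul_sq {n : ℕ} (χ : EuclideanSpace ℝ (Fin n) → ℝ) {ε : ℝ} (hε : 0 < ε)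
    (y : EuclideanSpace ℝ (Fin n)) :
    cutoffGaussian χ ε (ε • y) ^ 2 = χ (ε • y) ^ 2 * Real.exp (-‖y‖ ^ 2) := by
  rw [cutoffGaussian, mul_pow, exp_neg_mul_norm_smul_sq hε]

theorem norm_fderiv_cutoffGaussian_smul_sq {n : ℕ} {χ : EuclideanSpace ℝ (Fin n) → ℝ}
    (hχ : Differentiable ℝ χ) {ε : ℝ} (hε : 0 < ε) (y : EuclideanSpace ℝ (Fin n)) :
    ε ^ 2 * ‖fderiv ℝ (cutoffGaussian χ ε) (ε • y)‖ ^ 2 =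
      ‖ε • fderiv ℝ χ (ε • y) - χ (ε • y) • innerSL ℝ y‖ ^ 2 * Real.exp (-‖y‖ ^ 2) := by
  have h : HasFDerivAt (cutoffGaussian χ ε) _ (ε • y) := (hχ (ε • y)).hasFDerivAt.mul
    ((hasStrictFDerivAt_norm_sq (ε • y)).hasFDerivAt.const_mul (-((ε⁻¹) ^ 2 / 2))).exp
  have e : ε • fderiv ℝ (cutoffGaussian χ ε) (ε • y) =
      Real.exp (-((ε⁻¹) ^ 2 / 2) * ‖ε • y‖ ^ 2) •
        (ε • fderiv ℝ χ (ε • y) - χ (ε • y) • innerSL ℝ y) := by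
    rw [h.fderiv]
    ext v
    simp
    field_simp
    ring
  have e' := congrArg (‖·‖ ^ 2) e
  beta_reduce at e'
  rw [norm_smul, norm_smul, mul_pow, mul_pow, Real.norm_eq_abs, Real.norm_eq_abs, sq_abs, sq_abs,
    exp_neg_mul_norm_smul_sq hε] at e'
  rw [e', mul_comm]

theorem integral_smul_eq {n : ℕ} {ε : ℝ} (hε : 0 < ε) (f : EuclideanSpace ℝ (Fin n) → ℝ) :
    ∫ y, f (ε • y) = (ε ^ n)⁻¹ * ∫ x, f x := by
  rw [Measure.integral_comp_smul, abs_of_pos (by positivity)]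
  simp

theorem tendsto_quotient_cutoffGaussian {m : ℕ} {χ : EuclideanSpace ℝ (Fin (m + 2)) → ℝ}
    (hχ : ContDiff ℝ 1 χ) (hχs : tsupport χ ⊆ Metric.closedBall 0 (1 / 2))
    (hχ1 : ∀ x, |χ x| ≤ 1) (hχ0 : χ 0 = 1) :
    Tendsto (fun ε =>
        (∫ x, cutoffGaussian χ ε x ^ 2 * (dH x ^ 2 * lam x ^ (m + 2))) *
          (∫ x, ‖fderiv ℝ (cutoffGaussian χ ε) x‖ ^ 2 * lam x ^ m) /
          (∫ x, cutoffGaussian χ ε x ^ 2 * lam x ^ (m + 2)) ^ 2)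
      (𝓝[>] 0) (𝓝 (((m : ℝ) + 2) ^ 2 / 4)) := by
  have hχc := hχ.continuous
  have hcd : Continuous (fderiv ℝ χ) := hχ.continuous_fderiv one_ne_zero
  have hχcomp : HasCompactSupport χ :=
    (isCompact_closedBall _ _).of_isClosed_subset (isClosed_tsupport _) hχs
  obtain ⟨M, hM⟩ := hcd.bounded_above_of_compact_support (hχcomp.fderiv ℝ)
  have hM0 : 0 ≤ M := (norm_nonneg _).trans (hM 0)
  have hoff (x) (hx : ¬ ‖x‖ ≤ 1 / 2) : χ x = 0 ∧ fderiv ℝ χ x = 0 := by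
    have hx' : x ∉ tsupport χ := fun h => hx (by simpa using hχs h)
    exact ⟨image_eq_zero_of_notMem_tsupport hx',
      image_eq_zero_of_notMem_tsupport fun h => hx' (tsupport_fderiv_subset ℝ h)⟩
  have hlam (k : ℕ) {x : EuclideanSpace ℝ (Fin (m + 2))} (hx : ‖x‖ ≤ 1 / 2) :
      0 ≤ lam x ^ k ∧ lam x ^ k ≤ 3 ^ k := by
    have := lam_pos (hx.trans_lt one_half_lt_one)
    exact ⟨by positivity, by gcongr; exact lam_le_three hx⟩
  have hχsq (x) : χ x ^ 2 ≤ 1 := (sq_le_one_iff_abs_le_one _).2 (hχ1 x)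
  have hmlam := measurable_lam (n := m + 2)
  have hmdH := measurable_dH (n := m + 2)
  have hχlim (y) : Tendsto (fun ε : ℝ => χ (ε • y)) (𝓝[>] 0) (𝓝 1) := by
    simpa [hχ0] using! (hχc.tendsto 0).comp (tendsto_smul_nhdsGT_zero y)
  have hχ'lim (y) : Tendsto (fun ε : ℝ => fderiv ℝ χ (ε • y)) (𝓝[>] 0) (𝓝 (fderiv ℝ χ 0)) :=
    (hcd.tendsto 0).comp (tendsto_smul_nhdsGT_zero y)
  set G := ∫ y : EuclideanSpace ℝ (Fin (m + 2)), Real.exp (-‖y‖ ^ 2) with hG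
  have hG0 : 0 < G := integral_exp_neg_norm_sq_pos
  have hG2 := integral_norm_sq_mul_exp (n := m + 2)
  rw [← hG] at hG2
  have hA : Tendsto (fun ε : ℝ => ∫ y, (χ (ε • y) ^ 2 * ((ε⁻¹ * dH (ε • y)) ^ 2 *
      lam (ε • y) ^ (m + 2))) * Real.exp (-‖y‖ ^ 2)) (𝓝[>] 0)
      (𝓝 (∫ y : EuclideanSpace ℝ (Fin (m + 2)),
        (1 ^ 2 * ((2 * ‖y‖) ^ 2 * 2 ^ (m + 2))) * Real.exp (-‖y‖ ^ 2))) := by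
    refine tendsto_integral_mul_exp_neg_norm_sq (C := 4 ^ 2 * 3 ^ (m + 2)) (fun ε => by fun_prop)
      (fun ε hε _ y => ?_) fun y => ((hχlim y).pow 2).mul
        (((tendsto_dH_smul_div y).pow 2).mul ((tendsto_lam_smul y).pow _))
    by_cases hx : ‖ε • y‖ ≤ 1 / 2
    · obtain ⟨h1, h2⟩ := hlam (m + 2) hx
      have h3 : 0 ≤ dH (ε • y) := le_trans (by positivity)
        (two_mul_norm_le_dH (hx.trans_lt one_half_lt_one))
      have h4 : ε⁻¹ * dH (ε • y) ≤ 4 * ‖y‖ := by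
        rw [inv_mul_le_iff₀ hε]
        refine (dH_le_four_mul_norm hx).trans_eq ?_
        rw [norm_smul, Real.norm_of_nonneg hε.le]
        ring
      rw [abs_of_nonneg (by positivity)]
      calc _ ≤ 1 * ((4 * ‖y‖) ^ 2 * 3 ^ (m + 2)) := by gcongr; exact hχsq _
        _ = 4 ^ 2 * 3 ^ (m + 2) * ‖y‖ ^ 2 := by ring
        _ ≤ _ := by gcongr; linarith
    · rw [(hoff _ hx).1]
      simp
      positivity
  have hB : Tendsto (fun ε : ℝ => ∫ y, (‖ε • fderiv ℝ χ (ε • y) - χ (ε • y) • innerSL ℝ y‖ ^ 2 *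
      lam (ε • y) ^ m) * Real.exp (-‖y‖ ^ 2)) (𝓝[>] 0)
      (𝓝 (∫ y : EuclideanSpace ℝ (Fin (m + 2)),
        (‖(0 : ℝ) • fderiv ℝ χ 0 - (1 : ℝ) • innerSL ℝ y‖ ^ 2 * 2 ^ m) * Real.exp (-‖y‖ ^ 2))) := by
    refine tendsto_integral_mul_exp_neg_norm_sq (C := 2 * (M ^ 2 + 1) * 3 ^ m)
      (fun ε => Measurable.mul ?_ (by fun_prop))
      (fun ε hε hε1 y => ?_) fun y => Tendsto.mul (Tendsto.pow (Tendsto.norm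
        (Tendsto.sub (Tendsto.smul (tendsto_id.mono_left nhdsWithin_le_nhds) (hχ'lim y))
          ((hχlim y).smul_const _))) 2) ((tendsto_lam_smul y).pow m)
    · exact Continuous.measurable (by fun_prop)
    · by_cases hx : ‖ε • y‖ ≤ 1 / 2
      · obtain ⟨h1, h2⟩ := hlam m hx
        have h3 : ‖ε • fderiv ℝ χ (ε • y) - χ (ε • y) • innerSL ℝ y‖ ≤ M + ‖y‖ := by
          refine (norm_sub_le _ _).trans ?_
          rw [norm_smul, norm_smul, innerSL_apply_norm, Real.norm_of_nonneg hε.le,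
            Real.norm_eq_abs]
          calc _ ≤ 1 * M + 1 * ‖y‖ := by
                gcongr
                · exact hM _
                · exact hχ1 _
            _ = _ := by ring
        rw [abs_of_nonneg (by positivity)]
        calc _ ≤ (M + ‖y‖) ^ 2 * 3 ^ m := by gcongr
          _ ≤ (2 * (M ^ 2 + 1) * (1 + ‖y‖ ^ 2)) * 3 ^ m := by
            gcongr
            nlinarith [sq_nonneg (M - ‖y‖), mul_nonneg (sq_nonneg M) (sq_nonneg ‖y‖)]
          _ = _ := by ring
      · rw [(hoff _ hx).1, (hoff _ hx).2]
        simp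
        positivity
  have hC : Tendsto (fun ε : ℝ => ∫ y, (χ (ε • y) ^ 2 * lam (ε • y) ^ (m + 2)) *
      Real.exp (-‖y‖ ^ 2)) (𝓝[>] 0)
      (𝓝 (∫ y : EuclideanSpace ℝ (Fin (m + 2)),
        (1 ^ 2 * 2 ^ (m + 2)) * Real.exp (-‖y‖ ^ 2))) := by
    refine tendsto_integral_mul_exp_neg_norm_sq (C := 3 ^ (m + 2)) (fun ε => by fun_prop)
      (fun ε _ _ y => ?_) fun y => ((hχlim y).pow 2).mul ((tendsto_lam_smul y).pow _)
    by_cases hx : ‖ε • y‖ ≤ 1 / 2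
    · obtain ⟨h1, h2⟩ := hlam (m + 2) hx
      rw [abs_of_nonneg (by positivity)]
      calc χ (ε • y) ^ 2 * lam (ε • y) ^ (m + 2) ≤ 1 * 3 ^ (m + 2) := by gcongr; exact hχsq _
        _ ≤ 3 ^ (m + 2) * (1 + ‖y‖ ^ 2) := by
          rw [one_mul]
          exact le_mul_of_one_le_right (by positivity) (by linarith [sq_nonneg ‖y‖])
    · rw [(hoff _ hx).1]
      simp
      positivity
  have lA : ∫ y : EuclideanSpace ℝ (Fin (m + 2)),
      (1 ^ 2 * ((2 * ‖y‖) ^ 2 * 2 ^ (m + 2))) * Real.exp (-‖y‖ ^ 2) =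
        2 ^ (m + 4) * ((m + 2) / 2 * G) := by
    push_cast at hG2
    rw [← hG2, ← integral_const_mul]
    congr 1 with y
    ring
  have lB : ∫ y : EuclideanSpace ℝ (Fin (m + 2)),
      (‖(0 : ℝ) • fderiv ℝ χ 0 - (1 : ℝ) • innerSL ℝ y‖ ^ 2 * 2 ^ m) * Real.exp (-‖y‖ ^ 2) =
        2 ^ m * ((m + 2) / 2 * G) := by
    push_cast at hG2
    rw [← hG2, ← integral_const_mul]
    congr 1 with y
    rw [zero_smul, one_smul, zero_sub, norm_neg, innerSL_apply_norm]
    ring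
  have lC : ∫ y : EuclideanSpace ℝ (Fin (m + 2)),
      (1 ^ 2 * 2 ^ (m + 2)) * Real.exp (-‖y‖ ^ 2) = 2 ^ (m + 2) * G := by
    rw [integral_const_mul]
    ring
  rw [lA] at hA
  rw [lB] at hB
  rw [lC] at hC
  have hlimit : 2 ^ (m + 4) * (((m : ℝ) + 2) / 2 * G) * (2 ^ m * ((m + 2) / 2 * G)) /
      (2 ^ (m + 2) * G) ^ 2 = ((m : ℝ) + 2) ^ 2 / 4 := by
    rw [div_eq_div_iff (by positivity) (by norm_num)]
    ring
  rw [← hlimit]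
  refine ((hA.mul hB).div (hC.pow 2) (by positivity)).congr' ?_
  filter_upwards [self_mem_nhdsWithin] with ε (hε : 0 < ε)
  have eA : ∫ y, (χ (ε • y) ^ 2 * ((ε⁻¹ * dH (ε • y)) ^ 2 * lam (ε • y) ^ (m + 2))) *
      Real.exp (-‖y‖ ^ 2) = (ε ^ 2)⁻¹ * ((ε ^ (m + 2))⁻¹ *
        ∫ x, cutoffGaussian χ ε x ^ 2 * (dH x ^ 2 * lam x ^ (m + 2))) := by
    rw [← integral_smul_eq hε, ← integral_const_mul]
    congr 1 with y
    rw [cutoffGaussian_smul_sq χ hε]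
    ring
  have eB : ∫ y, (‖ε • fderiv ℝ χ (ε • y) - χ (ε • y) • innerSL ℝ y‖ ^ 2 * lam (ε • y) ^ m) *
      Real.exp (-‖y‖ ^ 2) = ε ^ 2 * ((ε ^ (m + 2))⁻¹ *
        ∫ x, ‖fderiv ℝ (cutoffGaussian χ ε) x‖ ^ 2 * lam x ^ m) := by
    rw [← integral_smul_eq hε (fun x => ‖fderiv ℝ (cutoffGaussian χ ε) x‖ ^ 2 * lam x ^ m),
      ← integral_const_mul]
    congr 1 with y
    rw [← mul_assoc, norm_fderiv_cutoffGaussian_smul_sq (hχ.differentiable one_ne_zero) hε]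
    ring
  have eC : ∫ y, (χ (ε • y) ^ 2 * lam (ε • y) ^ (m + 2)) * Real.exp (-‖y‖ ^ 2) =
      (ε ^ (m + 2))⁻¹ * ∫ x, cutoffGaussian χ ε x ^ 2 * lam x ^ (m + 2) := by
    rw [← integral_smul_eq hε]
    congr 1 with y
    rw [cutoffGaussian_smul_sq χ hε]
    ring
  simp only [Pi.div_apply]
  rw [eA, eB, eC]
  field_simp

theorem quotient_eq {m : ℕ} {φ : EuclideanSpace ℝ (Fin (m + 2)) → ℝ}
    (hs : tsupport φ ⊆ Metric.ball 0 1) :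
    (∫ x in Metric.ball (0 : EuclideanSpace ℝ (Fin (m + 2))) 1,
        dH x ^ 2 * φ x ^ 2 * lam x ^ ((m + 2 : ℕ) : ℝ)) *
      (∫ x in Metric.ball (0 : EuclideanSpace ℝ (Fin (m + 2))) 1,
        ‖gradient φ x‖ ^ 2 * lam x ^ (((m + 2 : ℕ) : ℝ) - 2)) /
      (∫ x in Metric.ball (0 : EuclideanSpace ℝ (Fin (m + 2))) 1,
        φ x ^ 2 * lam x ^ ((m + 2 : ℕ) : ℝ)) ^ 2 =
    (∫ x, φ x ^ 2 * (dH x ^ 2 * lam x ^ (m + 2))) *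
      (∫ x, ‖fderiv ℝ φ x‖ ^ 2 * lam x ^ m) / (∫ x, φ x ^ 2 * lam x ^ (m + 2)) ^ 2 := by
  have hoff (x) (hx : x ∉ Metric.ball 0 1) : φ x = 0 ∧ fderiv ℝ φ x = 0 :=
    ⟨image_eq_zero_of_notMem_tsupport fun h => hx (hs h),
      image_eq_zero_of_notMem_tsupport fun h => hx (hs (tsupport_fderiv_subset ℝ h))⟩
  have e : ((m + 2 : ℕ) : ℝ) - 2 = m := by push_cast; ring
  simp only [e, Real.rpow_natCast, gradient, LinearIsometryEquiv.norm_map]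
  rw [setIntegral_eq_integral_of_forall_compl_eq_zero fun x hx => by simp [(hoff x hx).1],
    setIntegral_eq_integral_of_forall_compl_eq_zero fun x hx => by simp [(hoff x hx).2],
    setIntegral_eq_integral_of_forall_compl_eq_zero fun x hx => by simp [(hoff x hx).1]]
  simp only [mul_assoc, mul_left_comm (dH _ ^ 2)]

theorem integral_sq_mul_lam_pow_pos {n : ℕ} {φ : EuclideanSpace ℝ (Fin n) → ℝ}
    (hφ : Continuous φ) (hc : HasCompactSupport φ) (hs : tsupport φ ⊆ Metric.ball 0 1)
    (h0 : φ ≠ 0) (k : ℕ) : 0 < ∫ x, φ x ^ 2 * lam x ^ k := by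
  obtain ⟨x, hx⟩ := Function.ne_iff.1 h0
  have hball {y} (hy : φ y ≠ 0) : 0 < lam y :=
    lam_pos (mem_ball_zero_iff.1 (hs (subset_tsupport _ hy)))
  have hsq : tsupport (fun x => φ x ^ 2) ⊆ tsupport φ := by
    simpa only [sq] using! tsupport_mul_subset_left (f := φ) (g := φ)
  refine (continuous_mul_of_tsupport_subset (hφ.pow 2) Metric.isOpen_ball (hsq.trans hs)
    (continuousOn_lam.pow k)).integral_pos_of_hasCompactSupport_nonneg_nonzero (x := x)
    ((hc.comp_left (g := fun t => t ^ 2) (by simp)).mul_right) (fun y => ?_) ?_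
  · by_cases hy : φ y = 0
    · simp [hy]
    · have := hball hy
      simp only [Pi.zero_apply]
      positivity
  · exact mul_ne_zero (pow_ne_zero 2 hx) (pow_ne_zero k (hball hx).ne')

/-- Sharpness of the constant `n²/4` in the uncertainty principle inequality on ℍⁿ
(Theorem 4.2, sharpness part). -/
theorem uncertainty_principle_hyperbolic_sharp {n : ℕ} (hn : 2 < n) :
    sInf { r : ℝ | ∃ φ : EuclideanSpace ℝ (Fin n) → ℝ,
        ContDiff ℝ (⊤ : ℕ∞) φ ∧ HasCompactSupport φ ∧
        tsupport φ ⊆ Metric.ball (0 : EuclideanSpace ℝ (Fin n)) 1 ∧ φ ≠ 0 ∧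
        r = (∫ x in Metric.ball (0 : EuclideanSpace ℝ (Fin n)) 1,
              dH x ^ 2 * φ x ^ 2 * lam x ^ (n : ℝ)) *
            (∫ x in Metric.ball (0 : EuclideanSpace ℝ (Fin n)) 1,
              ‖gradient φ x‖ ^ 2 * lam x ^ ((n : ℝ) - 2)) /
            (∫ x in Metric.ball (0 : EuclideanSpace ℝ (Fin n)) 1,
              φ x ^ 2 * lam x ^ (n : ℝ)) ^ 2 } =
      (n : ℝ) ^ 2 / 4 := by
  obtain ⟨m, rfl⟩ : ∃ m, n = m + 2 := ⟨n - 2, by omega⟩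
  let χ : ContDiffBump (0 : EuclideanSpace ℝ (Fin (m + 2))) :=
    ⟨1 / 4, 1 / 2, by norm_num, by norm_num⟩
  have hχs : tsupport χ = Metric.closedBall 0 (1 / 2) := χ.tsupport_eq
  have hχ0 : χ 0 = 1 := χ.one_of_mem_closedBall (Metric.mem_closedBall_self χ.rIn_pos.le)
  have hlim := tendsto_quotient_cutoffGaussian (m := m) (χ := χ) χ.contDiff hχs.subset
    (fun x => by rw [abs_of_nonneg χ.nonneg]; exact χ.le_one) hχ0
  have hφs (ε : ℝ) : tsupport (cutoffGaussian χ ε) ⊆ Metric.ball 0 1 :=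
    (tsupport_mul_subset_left.trans hχs.subset).trans
      (Metric.closedBall_subset_ball one_half_lt_one)
  have hφ (ε : ℝ) : ContDiff ℝ (⊤ : ℕ∞) (cutoffGaussian χ ε) :=
    χ.contDiff.mul (Real.contDiff_exp.comp (contDiff_const.mul (contDiff_norm_sq ℝ)))
  have hφ0 (ε : ℝ) : cutoffGaussian χ ε ≠ 0 := fun h => by
    simpa [cutoffGaussian, hχ0] using congrFun h 0
  refine csInf_eq_of_forall_ge_of_forall_gt_exists_lt
    ⟨_, cutoffGaussian χ 1, hφ 1, χ.hasCompactSupport.mul_right, hφs 1, hφ0 1, rfl⟩ ?_ ?_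
  · rintro _ ⟨φ, hφ, hc, hs, h0, rfl⟩
    have hφ1 : ContDiff ℝ 1 φ := hφ.of_le (by exact_mod_cast le_top)
    have hpos := integral_sq_mul_lam_pow_pos hφ.continuous hc hs h0 (m + 2)
    rw [quotient_eq hs, le_div_iff₀ (by positivity)]
    have := uncertainty_principle hφ1 hc hs
    push_cast
    linarith
  · intro b hb
    push_cast at hb
    obtain ⟨ε, hε⟩ := (hlim.eventually_lt_const hb).exists
    exact ⟨_, ⟨cutoffGaussian χ ε, hφ ε, χ.hasCompactSupport.mul_right, hφs ε, hφ0 ε, rfl⟩,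
      by rwa [quotient_eq (hφs ε)]⟩
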